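/- Let m ≥ 2, let η^{(1)}, …, η^{(m−1)} ∈ ℂ^{N+1}, let Θ_i = Θ(η^{(i)}) be the associated upper-left triangular Hankel matrices, and set Δ = Σ_{i=1}^{m−1} Θ_i Θ_i^* + I_{N+1}. Then Δ − Z Δ Z^* = Σ_{i=1}^{m−1} η^{(i)} (η^{(i)})^* + e_N e_N^*, and consequently the rank of Δ − Z Δ Z^* is at most m. -/

import Mathlib

open Matrix Finset

/-- Left multiplication by the shift matrix moves rows up by one. -/
lemma shift_mul_apply {N : ℕ} {Z : Matrix (Fin (N + 1)) (Fin (N + 1)) ℂ}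
    (hZ : ∀ j k : Fin (N + 1), Z j k = if (k : ℕ) = (j : ℕ) + 1 then 1 else 0)
    (M : Matrix (Fin (N + 1)) (Fin (N + 1)) ℂ) (j k : Fin (N + 1)) :
    (Z * M) j k = if h : (j : ℕ) + 1 ≤ N then M ⟨(j : ℕ) + 1, Nat.lt_succ_of_le h⟩ k else 0 := by
  rw [Matrix.mul_apply]
  split_ifs with h
  · rw [Finset.sum_eq_single ⟨(j : ℕ) + 1, Nat.lt_succ_of_le h⟩]
    · simp [hZ]
    · intro b _ hb
      rw [hZ, if_neg (fun hb' => hb (Fin.ext hb')), zero_mul]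
    · simp
  · refine Finset.sum_eq_zero fun b _ => ?_
    rw [hZ, if_neg (by omega), zero_mul]

/-- The shift matrix is a partial isometry whose defect is the last coordinate projection. -/
lemma one_sub_shift_mul_conjTranspose {N : ℕ} {Z : Matrix (Fin (N + 1)) (Fin (N + 1)) ℂ}
    (hZ : ∀ j k : Fin (N + 1), Z j k = if (k : ℕ) = (j : ℕ) + 1 then 1 else 0) :
    1 - Z * Zᴴ = Matrix.vecMulVec (Pi.single (Fin.last N) 1 : Fin (N + 1) → ℂ)
      (fun k => (starRingEnd ℂ) ((Pi.single (Fin.last N) 1 : Fin (N + 1) → ℂ) k)) := by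
  ext j l
  rw [Matrix.sub_apply, shift_mul_apply hZ, Matrix.vecMulVec_apply, Matrix.one_apply]
  simp only [Matrix.conjTranspose_apply, hZ, Pi.single_apply, Fin.ext_iff, Fin.val_last]
  have hj := j.isLt
  have hl := l.isLt
  split_ifs <;> first | omega | simp

/-- Displacement of `Θ Θᴴ` for an upper-left triangular Hankel matrix `Θ`. -/
lemma hankel_mul_conjTranspose_displacement {N : ℕ} {Z : Matrix (Fin (N + 1)) (Fin (N + 1)) ℂ}
    (hZ : ∀ j k : Fin (N + 1), Z j k = if (k : ℕ) = (j : ℕ) + 1 then 1 else 0)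
    {η : Fin (N + 1) → ℂ} {Θ : Matrix (Fin (N + 1)) (Fin (N + 1)) ℂ}
    (hΘ : ∀ j k : Fin (N + 1), Θ j k = if h : (j : ℕ) + (k : ℕ) ≤ N then
      η ⟨(j : ℕ) + (k : ℕ), Nat.lt_succ_of_le h⟩ else 0) :
    Θ * Θᴴ - Z * (Θ * Θᴴ) * Zᴴ =
      Matrix.vecMulVec η (fun k => (starRingEnd ℂ) (η k)) := by
  have hassoc : Z * (Θ * Θᴴ) * Zᴴ = (Z * Θ) * (Z * Θ)ᴴ := by
    simp only [Matrix.conjTranspose_mul, Matrix.mul_assoc]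
  have hzero (j : Fin (N + 1)) : Θ j 0 = η j := by
    rw [hΘ, dif_pos (by simpa using j.is_le)]
    simp
  have hlast (j : Fin (N + 1)) : (Z * Θ) j (Fin.last N) = 0 := by
    rw [shift_mul_apply hZ]
    split_ifs with h
    · rw [hΘ, dif_neg (by simp)]
    · rfl
  have hstep (j : Fin (N + 1)) (k : Fin N) : (Z * Θ) j k.castSucc = Θ j k.succ := by
    rw [shift_mul_apply hZ, hΘ j]
    simp only [Fin.val_succ]
    split_ifs with h h' h'
    · rw [hΘ, dif_pos (by simp only [Fin.val_castSucc]; omega)]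
      congr 2
      simp only [Fin.val_castSucc]
      omega
    · rw [hΘ, dif_neg (by simp only [Fin.val_castSucc]; omega)]
    · omega
    · rfl
  ext j l
  rw [hassoc, Matrix.sub_apply, Matrix.mul_apply, Matrix.mul_apply, Fin.sum_univ_succ,
    Fin.sum_univ_castSucc]
  simp only [Matrix.conjTranspose_apply, hzero, hlast, hstep, Matrix.vecMulVec_apply,
    starRingEnd_apply]
  ring

/-- A finite sum of outer products has rank at most the number of summands. -/
lemma rank_sum_vecMulVec_le {ι p q : Type*} [Fintype ι] [Fintype q] (u : ι → p → ℂ)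
    (v : ι → q → ℂ) : (∑ i, Matrix.vecMulVec (u i) (v i)).rank ≤ Fintype.card ι := by
  have h : ∑ i, Matrix.vecMulVec (u i) (v i) =
      (Matrix.of fun a i => u i a) * (Matrix.of fun i b => v i b) := by
    ext a b
    simp [Matrix.sum_apply, Matrix.mul_apply, Matrix.vecMulVec_apply]
  rw [h]
  exact (Matrix.rank_mul_le_left _ _).trans (Matrix.rank_le_card_width _)

/-- **Displacement structure of the matrix `Δ`.** For `Δ = ∑ Θ_i Θ_iᴴ + I`,
`Δ − Z Δ Zᴴ = ∑ η⁽ⁱ⁾ (η⁽ⁱ⁾)ᴴ + e_N e_Nᴴ`, hence `rank (Δ − Z Δ Zᴴ) ≤ m`. -/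
theorem delta_displacement_structure
    (N m : ℕ) (hm : 2 ≤ m)
    (η : Fin (m - 1) → Fin (N + 1) → ℂ)
    (Θ : Fin (m - 1) → Matrix (Fin (N + 1)) (Fin (N + 1)) ℂ)
    (hΘ : ∀ (i : Fin (m - 1)) (j k : Fin (N + 1)),
      Θ i j k = if h : (j : ℕ) + (k : ℕ) ≤ N then
        η i ⟨(j : ℕ) + (k : ℕ), Nat.lt_succ_of_le h⟩ else 0)
    (Z : Matrix (Fin (N + 1)) (Fin (N + 1)) ℂ)
    (hZ : ∀ j k : Fin (N + 1), Z j k = if (k : ℕ) = (j : ℕ) + 1 then 1 else 0)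
    (Δ : Matrix (Fin (N + 1)) (Fin (N + 1)) ℂ)
    (hΔ : Δ = (∑ i : Fin (m - 1), Θ i * (Θ i)ᴴ) + 1) :
    Δ - Z * Δ * Zᴴ =
      (∑ i : Fin (m - 1), Matrix.vecMulVec (η i) (fun k => (starRingEnd ℂ) (η i k))) +
        Matrix.vecMulVec (Pi.single (Fin.last N) 1 : Fin (N + 1) → ℂ)
          (fun k => (starRingEnd ℂ) ((Pi.single (Fin.last N) 1 : Fin (N + 1) → ℂ) k)) ∧
    (Δ - Z * Δ * Zᴴ).rank ≤ m := by
  have key : Δ - Z * Δ * Zᴴ =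
      (∑ i : Fin (m - 1), Matrix.vecMulVec (η i) (fun k => (starRingEnd ℂ) (η i k))) +
        Matrix.vecMulVec (Pi.single (Fin.last N) 1 : Fin (N + 1) → ℂ)
          (fun k => (starRingEnd ℂ) ((Pi.single (Fin.last N) 1 : Fin (N + 1) → ℂ) k)) := by
    rw [← one_sub_shift_mul_conjTranspose hZ,
      ← Finset.sum_congr rfl fun i _ => hankel_mul_conjTranspose_displacement hZ (hΘ i),
      Finset.sum_sub_distrib, ← Finset.sum_mul, ← Finset.mul_sum, hΔ]
    noncomm_ring
  refine ⟨key, ?_⟩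
  have hrank := rank_sum_vecMulVec_le
    (fun o : Option (Fin (m - 1)) => o.elim (Pi.single (Fin.last N) 1) η)
    (fun o => o.elim
      (fun k => (starRingEnd ℂ) ((Pi.single (Fin.last N) 1 : Fin (N + 1) → ℂ) k))
      (fun i k => (starRingEnd ℂ) (η i k)))
  rw [Fintype.sum_option, Fintype.card_option, Fintype.card_fin] at hrank
  rw [key, add_comm (∑ i, Matrix.vecMulVec (η i) _)]
  exact hrank.trans (by omega)
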